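/- For ℓ ≥ 3, let G be a P_ℓ-free graph. Suppose S ⊆ V(G) is such that |S|/(ℓ−1) is an integer and G[S] = Q₁ ∪ Q₂ ∪ ⋯ ∪ Q_τ, where Q₁, …, Q_τ are symmetric subgraphs of G with τ ≥ ℓ. If e(G[S]) + e_G(S, V(G)−S) ≥ ((ℓ−2)/2)|S|, then in fact e(G[S]) + e_G(S, V(G)−S) = ((ℓ−2)/2)|S|, and moreover: (i) if ℓ is odd, then Q_i = K_{ℓ−1} for all 1 ≤ i ≤ τ and e_G(S, V(G)−S) = 0; (ii) if ℓ is even, then either Q_i = K_{ℓ−1} for all 1 ≤ i ≤ τ and e_G(S, V(G)−S) = 0, or Q_i = K₁ for all 1 ≤ i ≤ τ and there are (ℓ−2)/2 vertices in V(G)−S each adjacent to the unique vertex of Q_i for every 1 ≤ i ≤ τ. -/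

import Mathlib

open SimpleGraph

/-- `G` contains a (not necessarily induced) copy of `F`. -/
def ContainsCopy {V W : Type*} (F : SimpleGraph V) (G : SimpleGraph W) : Prop :=
  ∃ f : V → W, Function.Injective f ∧ ∀ ⦃a b : V⦄, F.Adj a b → G.Adj (f a) (f b)

/-- `Q 0, …, Q (τ-1)` are symmetric subgraphs of the induced subgraph `G[A]`. -/
def SymmetricSubgraphsOn {V : Type*} (G : SimpleGraph V) (A : Set V) {τ : ℕ}
    (Q : Fin τ → Set V) : Prop :=
  (∀ i, Q i ⊆ A) ∧
  (∀ i, (G.induce (Q i)).Connected) ∧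
  (Pairwise fun i j => Disjoint (Q i) (Q j)) ∧
  ∃ ψ : ∀ i j : Fin τ, (Q i) ≃ (Q j),
    (∀ i j, ∀ a b : Q i, G.Adj (a : V) (b : V) ↔ G.Adj (ψ i j a : V) (ψ i j b : V)) ∧
    (∀ i j, ∀ u : Q i, ∀ v ∈ A \ ⋃ k, Q k,
      (G.Adj (u : V) v ↔ G.Adj (ψ i j u : V) v))

/-- Symmetric subgraphs of `G` itself. -/
abbrev SymmetricSubgraphs {V : Type*} (G : SimpleGraph V) {τ : ℕ} (Q : Fin τ → Set V) : Prop :=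
  SymmetricSubgraphsOn G Set.univ Q

/-- Number of edges of `G` inside a set `S`. -/
noncomputable def edgesWithin {V : Type*} (G : SimpleGraph V) (S : Set V) : ℕ :=
  (G.induce S).edgeSet.ncard

/-- Number of (ordered) adjacent pairs with first coordinate in `S`, second in `T`;
for disjoint `S`, `T` this is the number of edges of `G` between `S` and `T`. -/
noncomputable def edgesBetween {V : Type*} (G : SimpleGraph V) (S T : Set V) : ℕ :=
  {p : V × V | p.1 ∈ S ∧ p.2 ∈ T ∧ G.Adj p.1 p.2}.ncard

/-- The induced subgraph on a set `K` is a complete graph on `ℓ - 1` vertices. -/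
def IsCompleteOn {V : Type*} (G : SimpleGraph V) (K : Set V) (s : ℕ) : Prop :=
  K.ncard = s ∧ ∀ u ∈ K, ∀ v ∈ K, u ≠ v → G.Adj u v

/-- The neighbours of `v` in the finite set `X`. -/
noncomputable def nbrsIn {V : Type*} (G : SimpleGraph V) (X : Finset V) (v : V) : Finset V :=
  open scoped Classical in X.filter fun u => G.Adj v u

@[simp]
lemma mem_nbrsIn {V : Type*} {G : SimpleGraph V} {X : Finset V} {u v : V} :
    u ∈ nbrsIn G X v ↔ u ∈ X ∧ G.Adj v u := by
  simp [nbrsIn]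

/-- In a `P_ℓ`-free graph every list tracing out a path has fewer than `ℓ` entries. -/
lemma length_lt_of_pathFree {V : Type*} {G : SimpleGraph V} {ℓ : ℕ}
    (hfree : ¬ ContainsCopy (pathGraph ℓ) G) {l : List V} (hnd : l.Nodup)
    (hch : l.IsChain G.Adj) : l.length < ℓ := by
  by_contra! hlen
  refine hfree ⟨fun i => l[i.1]'(by omega), fun i j hij => ?_, fun a b hab => ?_⟩
  · exact Fin.ext ((hnd.getElem_inj_iff).1 hij)
  · rw [List.isChain_iff_getElem] at hch
    rw [pathGraph_adj] at hab
    rcases hab with h | h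
    · have := hch a.1 (by omega)
      simpa only [h] using this
    · have := (hch b.1 (by omega)).symm
      simpa only [h] using this

/-- A closed chain can be rotated to start at any of its entries. -/
lemma exists_rotated_chain {V : Type*} {G : SimpleGraph V} {c : List V}
    (hch : c.IsChain G.Adj) (hclose : ∀ y ∈ c.getLast?, ∀ x ∈ c.head?, G.Adj y x)
    {z : V} (hz : z ∈ c) : ∃ t : List V, (z :: t).Perm c ∧ (z :: t).IsChain G.Adj := by
  obtain ⟨s, t, rfl⟩ := List.append_of_mem hz
  refine ⟨t ++ s, ?_, ?_⟩
  · simpa using (List.perm_append_comm (l₁ := z :: t) (l₂ := s))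
  · rw [List.isChain_append] at hch
    rw [← List.cons_append, List.isChain_append]
    refine ⟨hch.2.1, hch.1, fun y hy x hx => hclose y ?_ x ?_⟩
    · simp only [List.getLast?_append, Option.mem_def] at hy ⊢
      simp [hy]
    · simp only [List.head?_append, Option.mem_def] at hx ⊢
      simp [hx]

/-- If the neighbours of both ends of a path lie on the path and the end degrees add up to at least
the number of vertices, then the vertices of the path form a cycle. -/
lemma exists_closed_chain {V : Type*} {G : SimpleGraph V} {l : List V} (W : Finset V)
    (hch : l.IsChain G.Adj) (hpos : 0 < l.length)
    (hx : ∀ u ∈ nbrsIn G W l[0], u ∈ l) (hy : ∀ u ∈ nbrsIn G W l[l.length - 1], u ∈ l)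
    (hdeg : l.length ≤ (nbrsIn G W l[0]).card + (nbrsIn G W l[l.length - 1]).card) :
    ∃ c : List V, c.Perm l ∧ c.IsChain G.Adj ∧
      ∀ y ∈ c.getLast?, ∀ x ∈ c.head?, G.Adj y x := by
  classical
  set p := l.length with hp
  let g : ℕ → V := fun i => l.getD i l[0]
  have hg : ∀ i (hi : i < p), g i = l[i] := fun i hi => by simp [g, List.getD, ← hp, hi]
  let I := (Finset.range (p - 1)).filter fun i => G.Adj l[0] (g (i + 1))
  let J := (Finset.range (p - 1)).filter fun i => G.Adj l[p - 1] (g i)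
  have hI : (nbrsIn G W l[0]).card ≤ I.card := by
    refine (Finset.card_le_card (t := I.image fun i => g (i + 1)) fun u hu => ?_).trans
      Finset.card_image_le
    obtain ⟨i, hi, rfl⟩ := List.getElem_of_mem (hx u hu)
    have hadj := (mem_nbrsIn.1 hu).2
    have hi0 : i ≠ 0 := by rintro rfl; exact G.irrefl hadj
    obtain ⟨k, rfl⟩ := Nat.exists_eq_succ_of_ne_zero hi0
    refine Finset.mem_image.2 ⟨k, Finset.mem_filter.2 ⟨Finset.mem_range.2 (by omega), ?_⟩, ?_⟩
    · rw [hg (k + 1) hi]; exact hadj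
    · exact hg (k + 1) hi
  have hJ : (nbrsIn G W l[l.length - 1]).card ≤ J.card := by
    refine (Finset.card_le_card (t := J.image g) fun u hu => ?_).trans Finset.card_image_le
    obtain ⟨i, hi, rfl⟩ := List.getElem_of_mem (hy u hu)
    have hadj := (mem_nbrsIn.1 hu).2
    have hi0 : i ≠ p - 1 := by rintro rfl; exact G.irrefl hadj
    refine Finset.mem_image.2 ⟨i, Finset.mem_filter.2 ⟨Finset.mem_range.2 (by omega), ?_⟩, hg i hi⟩
    rw [hg i hi]; exact hadj
  have hinter : (I ∩ J).Nonempty := by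
    rw [← Finset.card_pos]
    have h1 := Finset.card_union_add_card_inter I J
    have h2 : (I ∪ J).card ≤ p - 1 := by
      refine (Finset.card_le_card (t := Finset.range (p - 1)) ?_).trans (by simp)
      exact Finset.union_subset (Finset.filter_subset _ _) (Finset.filter_subset _ _)
    omega
  obtain ⟨i, hi⟩ := hinter
  simp only [Finset.mem_inter, I, J, Finset.mem_filter, Finset.mem_range] at hi
  obtain ⟨⟨hip, hxi⟩, -, hyi⟩ := hi
  rw [hg _ (by omega)] at hxi hyi
  have hch' := hch
  rw [← List.take_append_drop (i + 1) l, List.isChain_append] at hch'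
  refine ⟨l.take (i + 1) ++ (l.drop (i + 1)).reverse, ?_, ?_, ?_⟩
  · conv_rhs => rw [← List.take_append_drop (i + 1) l]
    exact (List.reverse_perm _).append_left _
  · rw [List.isChain_append]
    refine ⟨hch'.1, ?_, ?_⟩
    · rw [List.isChain_reverse]
      exact hch'.2.1.imp fun a b h => h.symm
    · intro a ha b hb
      rw [List.head?_reverse, List.getLast?_drop, if_neg (by omega)] at hb
      rw [List.getLast?_take] at ha
      simp only [List.getLast?_eq_getElem?] at hb
      have hb' : b = l[p - 1] := by
        rw [List.getElem?_eq_getElem (by omega)] at hb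
        simpa [eq_comm] using hb
      have ha' : a = l[i] := by
        simpa [List.getElem?_eq_getElem (show i < l.length by omega), eq_comm] using ha
      rw [ha', hb']
      exact hyi.symm
  · intro a ha b hb
    have hb' : b = l[0] := by
      rw [List.head?_append, List.head?_take, if_neg (by omega), List.head?_eq_getElem?,
        List.getElem?_eq_getElem hpos] at hb
      simpa [eq_comm] using hb
    have ha' : a = l[i + 1] := by
      simpa [List.getLast?_append, List.getLast?_reverse, List.head?_drop,
        List.getElem?_eq_getElem (show i + 1 < l.length by omega), eq_comm] using ha
    rw [ha', hb']
    exact hxi.symm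

/-- Large minimum degree in a `P_ℓ`-free graph forces components with fewer than `ℓ` vertices. -/
lemma exists_small_closed_of_minDegree {V : Type*} {G : SimpleGraph V} {ℓ : ℕ}
    (hfree : ¬ ContainsCopy (pathGraph ℓ) G) (W : Finset V)
    (hdeg : ∀ v ∈ W, ℓ - 1 ≤ 2 * (nbrsIn G W v).card) {v : V} (hv : v ∈ W) :
    ∃ C ⊆ W, v ∈ C ∧ C.card ≤ ℓ - 1 ∧ ∀ u ∈ C, nbrsIn G W u ⊆ C := by
  classical
  let P : ℕ → Prop := fun n => ∃ l : List V, l.Nodup ∧ l.IsChain G.Adj ∧ (∀ u ∈ l, u ∈ W) ∧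
    v ∈ l ∧ l.length = n
  have hP1 : P 1 := ⟨[v], by simp, by simp, by simpa using hv, by simp, rfl⟩
  have hbound : ∀ n, P n → n < ℓ := by
    rintro n ⟨l, hnd, hch, -, -, rfl⟩
    exact length_lt_of_pathFree hfree hnd hch
  obtain ⟨n, hn, hmax⟩ : ∃ n, P n ∧ ¬ P (n + 1) := by
    by_contra! h
    have : ∀ n, P (n + 1) := fun n => by
      induction n with
      | zero => exact hP1
      | succ k ih => exact h _ ih
    exact absurd (hbound _ (this ℓ)) (by omega)
  have hnl := hbound n hn
  obtain ⟨l, hnd, hch, hlW, hvl, rfl⟩ := hn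
  have hext : ∀ z t, (z :: t).Perm l → (z :: t).IsChain G.Adj → ∀ u ∈ nbrsIn G W z, u ∈ l := by
    intro z t hperm hzt u hu
    by_contra hul
    have hu' := mem_nbrsIn.1 hu
    refine hmax ⟨u :: z :: t, ?_, ?_, ?_, ?_, ?_⟩
    · exact List.nodup_cons.2 ⟨fun h => hul (hperm.mem_iff.1 h), hperm.nodup_iff.2 hnd⟩
    · exact List.isChain_cons_cons.2 ⟨hu'.2.symm, hzt⟩
    · intro x hx
      rcases List.mem_cons.1 hx with rfl | hx
      · exact hu'.1
      · exact hlW x (hperm.mem_iff.1 hx)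
    · exact List.mem_cons_of_mem _ (hperm.mem_iff.2 hvl)
    · rw [List.length_cons, hperm.length_eq]
  have hpos : 0 < l.length := List.length_pos_of_mem hvl
  have hx : ∀ u ∈ nbrsIn G W l[0], u ∈ l := by
    obtain ⟨a, t, rfl⟩ := List.exists_cons_of_length_pos hpos
    exact hext a t (List.Perm.refl _) hch
  have hy : ∀ u ∈ nbrsIn G W l[l.length - 1], u ∈ l := by
    have hrev : l.reverse.IsChain G.Adj := by
      rw [List.isChain_reverse]
      exact hch.imp fun a b h => h.symm
    obtain ⟨a, t, hat⟩ := List.exists_cons_of_length_pos (l := l.reverse) (by simpa using hpos)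
    have ha : a = l[l.length - 1] := by
      have h0 : l.reverse[0]'(by simpa using hpos) = a := by simp [hat]
      rw [← h0, List.getElem_reverse]
      simp
    rw [← ha]
    exact hext a t (hat ▸ List.reverse_perm l) (hat ▸ hrev)
  have h0 := hdeg l[0] (hlW _ (List.getElem_mem _))
  have h1 := hdeg l[l.length - 1] (hlW _ (List.getElem_mem _))
  obtain ⟨c, hcl, hcch, hclose⟩ := exists_closed_chain W hch hpos hx hy (by omega)
  refine ⟨l.toFinset, fun u hu => hlW u (by simpa using hu), by simpa using hvl,
    (List.toFinset_card_le l).trans (by omega), fun z hz u hu => ?_⟩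
  obtain ⟨t, ht, htch⟩ := exists_rotated_chain hcch hclose
    (hcl.mem_iff.2 (List.mem_toFinset.1 hz))
  exact List.mem_toFinset.2 (hext z t (ht.trans hcl) htch u hu)

/-- A clique on `ℓ - 1` vertices in a `P_ℓ`-free graph has no outside neighbours. -/
lemma not_adj_of_clique {V : Type*} {G : SimpleGraph V} {ℓ : ℕ} (hℓ : 3 ≤ ℓ)
    (hfree : ¬ ContainsCopy (pathGraph ℓ) G) {C : Finset V} (hcard : C.card = ℓ - 1)
    (hC : ∀ u ∈ C, ∀ z ∈ C, u ≠ z → G.Adj u z) {u v : V} (hu : u ∈ C) (hv : v ∉ C) :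
    ¬ G.Adj v u := by
  classical
  intro hadj
  have hnd : (v :: u :: (C.erase u).toList).Nodup := by
    simp only [List.nodup_cons, List.mem_cons, Finset.mem_toList, Finset.mem_erase,
      Finset.nodup_toList, not_or]
    refine ⟨⟨fun h => hv (h ▸ hu), fun h => hv h.2⟩, by simp, trivial⟩
  have hch : (v :: u :: (C.erase u).toList).IsChain G.Adj := by
    refine List.isChain_cons_cons.2 ⟨hadj, List.Pairwise.isChain ?_⟩
    refine List.Pairwise.imp_of_mem ?_ (List.nodup_cons.1 hnd).2
    intro a b ha hb hab
    refine hC a ?_ b ?_ hab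
    · simp only [List.mem_cons, Finset.mem_toList, Finset.mem_erase] at ha
      rcases ha with rfl | ha
      exacts [hu, ha.2]
    · simp only [List.mem_cons, Finset.mem_toList, Finset.mem_erase] at hb
      rcases hb with rfl | hb
      exacts [hu, hb.2]
  have := length_lt_of_pathFree hfree hnd hch
  simp only [List.length_cons, Finset.length_toList, Finset.card_erase_of_mem hu, hcard] at this
  omega

/-- Maps `φ i` producing disjoint copies of the vertex set `D`, all attached to `A` alike. -/
structure SymmetricCopies {V ι : Type*} (G : SimpleGraph V) (D A : Finset V)
    (φ : ι → V → V) : Prop where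
  inj : ∀ i j, ∀ u ∈ D, ∀ v ∈ D, φ i u = φ j v → i = j ∧ u = v
  adj : ∀ i, ∀ u ∈ D, ∀ v ∈ D, G.Adj u v → G.Adj (φ i u) (φ i v)
  notMem : ∀ i, ∀ u ∈ D, φ i u ∉ A
  adj_out : ∀ i, ∀ u ∈ D, ∀ a ∈ A, G.Adj u a → G.Adj (φ i u) a

lemma SymmetricCopies.exists_alternating_chain {V ι : Type*} {G : SimpleGraph V} {D A : Finset V}
    {φ : ι → V → V} (hφ : SymmetricCopies G D A φ) {x : V} (hx : x ∈ D) :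
    ∀ (as : List V) (is : List ι) (i : ι), as.length = is.length → (i :: is).Nodup → as.Nodup →
      (∀ a ∈ as, a ∈ A ∧ G.Adj x a) → ∃ t : List V, (φ i x :: t).Nodup ∧
        (φ i x :: t).IsChain G.Adj ∧ t.length = 2 * as.length ∧
        ∀ y ∈ t, (∃ j ∈ is, y = φ j x) ∨ y ∈ as
  | [], [], i, _, _, _, _ => ⟨[], by simp, by simp, rfl, by simp⟩
  | [], _ :: _, _, h, _, _, _ => by simp at h
  | _ :: _, [], _, h, _, _, _ => by simp at h
  | a :: as, j :: is, i, hlen, hi, ha, hA => by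
    obtain ⟨t, hnd, hch, ht, hmem⟩ := hφ.exists_alternating_chain hx as is j (by simpa using hlen)
      (List.nodup_cons.1 hi).2 (List.nodup_cons.1 ha).2
      fun b hb => hA b (List.mem_cons_of_mem _ hb)
    have haA := hA a (by simp)
    have hmem' : ∀ y ∈ φ j x :: t, (∃ k ∈ j :: is, y = φ k x) ∨ y ∈ as := by
      intro y hy
      rcases List.mem_cons.1 hy with rfl | hy
      · exact Or.inl ⟨j, by simp, rfl⟩
      · rcases hmem y hy with ⟨k, hk, rfl⟩ | h
        · exact Or.inl ⟨k, by simp [hk], rfl⟩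
        · exact Or.inr h
    refine ⟨a :: φ j x :: t, ?_, ?_, ?_, ?_⟩
    · refine List.nodup_cons.2 ⟨?_, List.nodup_cons.2 ⟨?_, hnd⟩⟩
      · intro h
        rcases List.mem_cons.1 h with h | h
        · exact hφ.notMem i x hx (h ▸ haA.1)
        · rcases hmem' _ h with ⟨k, hk, h⟩ | h
          · obtain ⟨rfl, -⟩ := hφ.inj _ _ x hx x hx h
            exact (List.nodup_cons.1 hi).1 hk
          · exact hφ.notMem i x hx (hA _ (List.mem_cons_of_mem _ h)).1
      · intro h
        rcases hmem' _ h with ⟨k, hk, h⟩ | h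
        · exact hφ.notMem k x hx (h ▸ haA.1)
        · exact (List.nodup_cons.1 ha).1 h
    · exact List.isChain_cons_cons.2 ⟨hφ.adj_out i x hx a haA.1 haA.2,
        List.isChain_cons_cons.2 ⟨(hφ.adj_out j x hx a haA.1 haA.2).symm, hch⟩⟩
    · simp only [List.length_cons, ht]; ring
    · intro y hy
      rcases List.mem_cons.1 hy with rfl | hy
      · simp
      · rcases hmem' y hy with h | h
        · exact Or.inl h
        · exact Or.inr (List.mem_cons_of_mem _ h)

lemma SymmetricCopies.not_adj_of_card_nbrsIn {V : Type*} {τ ℓ : ℕ} {G : SimpleGraph V}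
    {D A : Finset V} {φ : Fin τ → V → V} (hφ : SymmetricCopies G D A φ) (hℓ : 3 ≤ ℓ) (hτ : ℓ ≤ τ)
    (hfree : ¬ ContainsCopy (pathGraph ℓ) G) {x v : V} (hx : x ∈ D) (hv : v ∈ D)
    (hw : 2 * (nbrsIn G A x).card = ℓ - 2) : ¬ G.Adj v x := by
  intro hadj
  obtain ⟨n, hn⟩ : ∃ n, n = (nbrsIn G A x).card := ⟨_, rfl⟩
  obtain ⟨i, is, his, hisl⟩ : ∃ i : Fin τ, ∃ is : List (Fin τ), (i :: is).Nodup ∧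
      is.length = n := by
    have h1 := ((List.nodup_finRange τ).sublist (List.take_sublist (n + 1) _))
    have h2 : ((List.finRange τ).take (n + 1)).length = n + 1 := by
      simp only [List.length_take, List.length_finRange]; omega
    obtain ⟨i, is, h⟩ := List.exists_cons_of_length_pos (l := (List.finRange τ).take (n + 1))
      (by omega)
    rw [h] at h1 h2
    exact ⟨i, is, h1, by simpa using h2⟩
  obtain ⟨t, hnd, hch, ht, hmem⟩ := hφ.exists_alternating_chain hx (nbrsIn G A x).toList is i
    (by rw [hisl, Finset.length_toList, hn]) his (Finset.nodup_toList _)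
    (fun a ha => mem_nbrsIn.1 (Finset.mem_toList.1 ha))
  have hne : v ≠ x := hadj.ne
  have := length_lt_of_pathFree hfree (l := φ i v :: φ i x :: t) (List.nodup_cons.2 ⟨?_, hnd⟩)
    (List.isChain_cons_cons.2 ⟨hφ.adj i v hv x hx hadj, hch⟩)
  · simp only [List.length_cons, ht, Finset.length_toList] at this
    omega
  · intro h
    rcases List.mem_cons.1 h with h | h
    · exact hne (hφ.inj _ _ v hv x hx h).2
    · rcases hmem _ h with ⟨j, -, h⟩ | h
      · exact hne (hφ.inj _ _ v hv x hx h).2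
      · exact hφ.notMem i v hv (mem_nbrsIn.1 (Finset.mem_toList.1 h)).1

/-- The component of `v` in `G[X]` is a `K_{ℓ-1}` without neighbours in `A`. -/
def InCliqueComponent {V : Type*} (G : SimpleGraph V) (ℓ : ℕ) (A X : Finset V) (v : V) : Prop :=
  ∃ C ⊆ X, v ∈ C ∧ C.card = ℓ - 1 ∧ (∀ u ∈ C, ∀ z ∈ C, u ≠ z → G.Adj u z) ∧
    (∀ u ∈ C, nbrsIn G X u ⊆ C) ∧ ∀ u ∈ C, nbrsIn G A u = ∅

/-- The vertex `v` is isolated in `G[X]` and has `(ℓ-2)/2` neighbours in `A`. -/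
def IsHalfIsolated {V : Type*} (G : SimpleGraph V) (ℓ : ℕ) (A X : Finset V) (v : V) : Prop :=
  nbrsIn G X v = ∅ ∧ 2 * (nbrsIn G A v).card = ℓ - 2

lemma sum_card_nbrsIn_erase {V : Type*} [DecidableEq V] (G : SimpleGraph V) {X : Finset V} {v : V}
    (hv : v ∈ X) :
    ∑ u ∈ X, (nbrsIn G X u).card =
      ∑ u ∈ X.erase v, (nbrsIn G (X.erase v) u).card + 2 * (nbrsIn G X v).card := by
  classical
  have hpt : ∀ u ∈ X.erase v, (nbrsIn G X u).card =
      (nbrsIn G (X.erase v) u).card + if G.Adj v u then 1 else 0 := by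
    intro u hu
    have h : nbrsIn G (X.erase v) u = (nbrsIn G X u).erase v := by
      ext z; simp only [mem_nbrsIn, Finset.mem_erase]; tauto
    rw [h]
    split_ifs with hadj
    · rw [Finset.card_erase_add_one (mem_nbrsIn.2 ⟨hv, hadj.symm⟩)]
    · rw [Finset.erase_eq_of_notMem fun h => hadj (mem_nbrsIn.1 h).2.symm, add_zero]
  have hcount : (nbrsIn G X v).card = ∑ u ∈ X.erase v, if G.Adj v u then 1 else 0 := by
    rw [← Finset.card_filter]
    congr 1
    ext z
    simp only [mem_nbrsIn, Finset.mem_filter, Finset.mem_erase]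
    exact ⟨fun h => ⟨⟨h.2.ne', h.1⟩, h.2⟩, fun h => ⟨h.1.2, h.2⟩⟩
  rw [← Finset.add_sum_erase X _ hv, Finset.sum_congr rfl hpt, Finset.sum_add_distrib, ← hcount]
  ring

/-- If every vertex of `X` has large degree into `X ∪ A`, then nothing in `X` is joined to `A`. -/
lemma SymmetricCopies.nbrsIn_eq_empty {V : Type*} {τ ℓ : ℕ} {G : SimpleGraph V}
    {D A : Finset V} {φ : Fin τ → V → V} (hφ : SymmetricCopies G D A φ) (hℓ : 3 ≤ ℓ) (hτ : ℓ ≤ τ)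
    (hfree : ¬ ContainsCopy (pathGraph ℓ) G) {X : Finset V} (hX : X ⊆ D)
    (hdeg : ∀ v ∈ X, ℓ - 1 ≤ 2 * ((nbrsIn G X v).card + (nbrsIn G A v).card)) :
    ∀ v ∈ X, nbrsIn G A v = ∅ := by
  classical
  intro v hv
  by_contra hne
  obtain ⟨a, ha⟩ := Finset.nonempty_iff_ne_empty.2 hne
  let U : Finset V := (Finset.univ ×ˢ X).image fun p : Fin τ × V => φ p.1 p.2
  let B : Finset V := X.biUnion fun u => nbrsIn G A u
  have hU : ∀ i, ∀ u ∈ X, φ i u ∈ U := fun i u hu =>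
    Finset.mem_image.2 ⟨(i, u), by simpa using hu, rfl⟩
  have hB : ∀ u ∈ X, ∀ b ∈ nbrsIn G A u, τ ≤ (nbrsIn G (U ∪ B) b).card := by
    intro u hu b hb
    rw [mem_nbrsIn] at hb
    have hinj : Function.Injective fun i => φ i u := fun i j h =>
      (hφ.inj i j u (hX hu) u (hX hu) h).1
    calc τ = (Finset.univ.image fun i : Fin τ => φ i u).card := by
          rw [Finset.card_image_of_injective _ hinj]; simp
      _ ≤ _ := by
          refine Finset.card_le_card fun z hz => ?_
          obtain ⟨i, -, rfl⟩ := Finset.mem_image.1 hz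
          exact mem_nbrsIn.2 ⟨Finset.mem_union_left _ (hU i u hu),
            (hφ.adj_out i u (hX hu) b hb.1 hb.2).symm⟩
  have haB : a ∈ B := Finset.mem_biUnion.2 ⟨v, hv, ha⟩
  obtain ⟨C, -, haC, hC, hclosed⟩ := exists_small_closed_of_minDegree hfree (U ∪ B) (v := a)
    (by
      intro z hz
      rcases Finset.mem_union.1 hz with hz | hz
      · obtain ⟨⟨i, u⟩, hu, rfl⟩ := Finset.mem_image.1 hz
        have hu : u ∈ X := by simpa using hu
        refine (hdeg u hu).trans (Nat.mul_le_mul_left 2 ?_)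
        have hinj : Set.InjOn (φ i) (nbrsIn G X u) := by
          intro y hy z hz h
          exact (hφ.inj i i y (hX (mem_nbrsIn.1 hy).1) z (hX (mem_nbrsIn.1 hz).1) h).2
        have hdis : Disjoint ((nbrsIn G X u).image (φ i)) (nbrsIn G A u) := by
          rw [Finset.disjoint_left]
          intro z hz hzA
          obtain ⟨y, hy, rfl⟩ := Finset.mem_image.1 hz
          exact hφ.notMem i y (hX (mem_nbrsIn.1 hy).1) (mem_nbrsIn.1 hzA).1
        rw [← Finset.card_image_of_injOn hinj, ← Finset.card_union_of_disjoint hdis]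
        refine Finset.card_le_card (Finset.union_subset (fun z hz => ?_) fun z hz => ?_)
        · obtain ⟨y, hy, rfl⟩ := Finset.mem_image.1 hz
          rw [mem_nbrsIn] at hy
          exact mem_nbrsIn.2 ⟨Finset.mem_union_left _ (hU i y hy.1),
            hφ.adj i u (hX hu) y (hX hy.1) hy.2⟩
        · have hz' := mem_nbrsIn.1 hz
          exact mem_nbrsIn.2 ⟨Finset.mem_union_right _ (Finset.mem_biUnion.2 ⟨u, hu, hz⟩),
            hφ.adj_out i u (hX hu) z hz'.1 hz'.2⟩
      · obtain ⟨u, hu, hz⟩ := Finset.mem_biUnion.1 hz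
        have := hB u hu z hz
        omega) (Finset.mem_union_right _ haB)
  have h1 := hB v hv a ha
  have h2 := Finset.card_le_card (hclosed a haC)
  omega

/-- Erdős–Gallai bound for large minimum degree, with the extremal structure. -/
lemma sum_card_nbrsIn_le_of_minDegree {V : Type*} {ℓ : ℕ} {G : SimpleGraph V}
    (hfree : ¬ ContainsCopy (pathGraph ℓ) G) {A X : Finset V}
    (hA : ∀ v ∈ X, nbrsIn G A v = ∅)
    (hdeg : ∀ v ∈ X, ℓ - 1 ≤ 2 * (nbrsIn G X v).card) :
    ∑ u ∈ X, (nbrsIn G X u).card ≤ (ℓ - 2) * X.card ∧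
      (∑ u ∈ X, (nbrsIn G X u).card = (ℓ - 2) * X.card →
        ∀ v ∈ X, InCliqueComponent G ℓ A X v) := by
  classical
  have herase : ∀ C : Finset V, (∀ u ∈ C, nbrsIn G X u ⊆ C) → ∀ u ∈ C,
      nbrsIn G X u ⊆ C.erase u := fun C hC u hu z hz =>
    Finset.mem_erase.2 ⟨(mem_nbrsIn.1 hz).2.ne', hC u hu hz⟩
  have hle : ∀ v ∈ X, (nbrsIn G X v).card ≤ ℓ - 2 := by
    intro v hv
    obtain ⟨C, -, hvC, hC, hclosed⟩ := exists_small_closed_of_minDegree hfree X hdeg hv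
    have := Finset.card_le_card (herase C hclosed v hvC)
    rw [Finset.card_erase_of_mem hvC] at this
    omega
  have hconst : (ℓ - 2) * X.card = ∑ _u ∈ X, (ℓ - 2) := by
    rw [Finset.sum_const, smul_eq_mul, mul_comm]
  rw [hconst]
  refine ⟨Finset.sum_le_sum hle, fun heq v hv => ?_⟩
  have hall := (Finset.sum_eq_sum_iff_of_le hle).1 heq
  obtain ⟨C, hCX, hvC, hC, hclosed⟩ := exists_small_closed_of_minDegree hfree X hdeg hv
  have hfull : ∀ u ∈ C, nbrsIn G X u = C.erase u := by
    intro u hu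
    refine Finset.eq_of_subset_of_card_le (herase C hclosed u hu) ?_
    rw [Finset.card_erase_of_mem hu, hall u (hCX hu)]
    omega
  have hvd := hdeg v hv
  have hcard := congrArg Finset.card (hfull v hvC)
  rw [hall v hv, Finset.card_erase_of_mem hvC] at hcard
  have hpos : 0 < C.card := Finset.card_pos.2 ⟨v, hvC⟩
  rw [hall v hv] at hvd
  refine ⟨C, hCX, hvC, by omega, fun u hu z hz huz => ?_, hclosed, fun u hu => hA u (hCX hu)⟩
  have : z ∈ nbrsIn G X u := by
    rw [hfull u hu]
    exact Finset.mem_erase.2 ⟨huz.symm, hz⟩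
  exact (mem_nbrsIn.1 this).2

/-- Erdős–Gallai bound for symmetric copies, with the extremal structure. -/
lemma SymmetricCopies.sum_le {V : Type*} {τ ℓ : ℕ} {G : SimpleGraph V}
    {D A : Finset V} {φ : Fin τ → V → V} (hφ : SymmetricCopies G D A φ) (hℓ : 3 ≤ ℓ) (hτ : ℓ ≤ τ)
    (hfree : ¬ ContainsCopy (pathGraph ℓ) G) :
    ∀ X ⊆ D,
      ∑ u ∈ X, (nbrsIn G X u).card + 2 * ∑ u ∈ X, (nbrsIn G A u).card ≤ (ℓ - 2) * X.card ∧
      (∑ u ∈ X, (nbrsIn G X u).card + 2 * ∑ u ∈ X, (nbrsIn G A u).card = (ℓ - 2) * X.card →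
        ∀ v ∈ X, InCliqueComponent G ℓ A X v ∨ IsHalfIsolated G ℓ A X v) := by
  classical
  intro X
  induction X using Finset.strongInduction with
  | H X ih =>
  intro hX
  by_cases hdeg : ∀ v ∈ X, ℓ - 1 ≤ 2 * ((nbrsIn G X v).card + (nbrsIn G A v).card)
  · have hA := hφ.nbrsIn_eq_empty hℓ hτ hfree hX hdeg
    have hz : ∑ u ∈ X, (nbrsIn G A u).card = 0 :=
      Finset.sum_eq_zero fun u hu => by rw [hA u hu, Finset.card_empty]
    have h := sum_card_nbrsIn_le_of_minDegree hfree hA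
      fun v hv => by simpa [hA v hv] using hdeg v hv
    rw [hz, mul_zero, add_zero]
    exact ⟨h.1, fun heq v hv => Or.inl (h.2 heq v hv)⟩
  · push Not at hdeg
    obtain ⟨v, hv, hlow⟩ := hdeg
    obtain ⟨hle, hext⟩ := ih (X.erase v) (Finset.erase_ssubset hv)
      ((Finset.erase_subset _ _).trans hX)
    rw [sum_card_nbrsIn_erase G hv, ← Finset.add_sum_erase X _ hv,
      ← Finset.card_erase_add_one hv, mul_add (ℓ - 2), mul_one]
    refine ⟨by omega, fun heq => ?_⟩
    have hext := hext (by omega)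
    have hiso : ∀ u ∈ X.erase v, ¬ G.Adj v u := by
      intro u hu
      rcases hext u hu with ⟨C, hCX, huC, hcard, hcl, -, -⟩ | h
      · exact not_adj_of_clique hℓ hfree hcard hcl huC
          fun h => (Finset.mem_erase.1 (hCX h)).1 rfl
      · exact hφ.not_adj_of_card_nbrsIn hℓ hτ hfree (hX (Finset.mem_erase.1 hu).2) (hX hv) h.2
    have hvempty : nbrsIn G X v = ∅ := by
      refine Finset.eq_empty_of_forall_notMem fun u hu => ?_
      rw [mem_nbrsIn] at hu
      exact hiso u (Finset.mem_erase.2 ⟨hu.2.ne', hu.1⟩) hu.2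
    have hsame : ∀ u ∈ X.erase v, nbrsIn G X u = nbrsIn G (X.erase v) u := by
      intro u hu
      ext z
      simp only [mem_nbrsIn, Finset.mem_erase]
      refine ⟨fun h => ⟨⟨?_, h.1⟩, h.2⟩, fun h => ⟨h.1.2, h.2⟩⟩
      rintro rfl
      exact hiso u hu h.2.symm
    intro u hu
    rcases eq_or_ne u v with rfl | huv
    · refine Or.inr ⟨hvempty, ?_⟩
      rw [hvempty, Finset.card_empty] at heq hlow
      omega
    · have hu' := Finset.mem_erase.2 ⟨huv, hu⟩
      rcases hext u hu' with ⟨C, hCX, huC, hcard, hcl, hclosed, hA⟩ | h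
      · refine Or.inl ⟨C, hCX.trans (Finset.erase_subset _ _), huC, hcard, hcl, fun z hz => ?_, hA⟩
        rw [hsame z (hCX hz)]
        exact hclosed z hz
      · exact Or.inr ⟨by rw [hsame u hu']; exact h.1, h.2⟩

/-- A nonempty subset of a connected vertex set that is closed under adjacency is everything. -/
lemma eq_of_connected_of_closed {V : Type*} {G : SimpleGraph V} {K : Set V} {X C : Finset V}
    (hK : (G.induce K).Connected) (hXK : ∀ v, v ∈ X ↔ v ∈ K) (hCX : C ⊆ X) {v : V} (hv : v ∈ C)
    (hclosed : ∀ u ∈ C, nbrsIn G X u ⊆ C) : C = X := by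
  refine Finset.Subset.antisymm hCX fun z hz => ?_
  obtain ⟨p⟩ := hK.preconnected ⟨v, (hXK v).1 (hCX hv)⟩ ⟨z, (hXK z).1 hz⟩
  have key : ∀ {a b : K}, (G.induce K).Walk a b → (a : V) ∈ C → (b : V) ∈ C := by
    intro a b p
    induction p with
    | nil => exact id
    | cons h _ ih =>
      intro ha
      exact ih (hclosed _ ha (mem_nbrsIn.2 ⟨(hXK _).2 (Subtype.property _), h⟩))
  exact key p hv

lemma two_mul_edgesWithin {V : Type*} [Fintype V] (G : SimpleGraph V) {S : Set V} {X : Finset V}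
    (hX : ∀ v, v ∈ X ↔ v ∈ S) : 2 * edgesWithin G S = ∑ u ∈ X, (nbrsIn G X u).card := by
  classical
  rw [edgesWithin, ← coe_edgeFinset, Set.ncard_coe_finset,
    ← (G.induce S).sum_degrees_eq_twice_card_edges,
    Finset.sum_subtype X hX (fun u => (nbrsIn G X u).card)]
  refine Finset.sum_congr rfl fun u _ => ?_
  rw [← card_neighborFinset_eq_degree,
    ← Finset.card_image_of_injective _ Subtype.val_injective]
  congr 1
  ext z
  simp [hX, and_comm]

lemma edgesBetween_eq_sum {V : Type*} (G : SimpleGraph V) {S T : Set V}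
    {X Y : Finset V} (hX : ∀ v, v ∈ X ↔ v ∈ S) (hY : ∀ v, v ∈ Y ↔ v ∈ T) :
    edgesBetween G S T = ∑ u ∈ X, (nbrsIn G Y u).card := by
  classical
  have h : {p : V × V | p.1 ∈ S ∧ p.2 ∈ T ∧ G.Adj p.1 p.2} =
      ((X ×ˢ Y).filter fun p => G.Adj p.1 p.2 : Finset (V × V)) := by
    ext p
    simp [hX, hY, and_assoc]
  rw [edgesBetween, h, Set.ncard_coe_finset, Finset.card_filter, Finset.sum_product]
  refine Finset.sum_congr rfl fun u _ => ?_
  rw [← Finset.card_filter, nbrsIn]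

/-- The isomorphisms between symmetric subgraphs give symmetric copies of each of them. -/
lemma exists_symmetricCopies {V : Type*} {G : SimpleGraph V} {τ : ℕ} {Q : Fin τ → Set V}
    (hsym : SymmetricSubgraphs G Q) {A : Finset V} (hA : ∀ v, v ∈ A ↔ v ∉ ⋃ i, Q i)
    (i : Fin τ) {D : Finset V} (hD : ∀ v, v ∈ D ↔ v ∈ Q i) :
    ∃ φ : Fin τ → V → V, SymmetricCopies G D A φ := by
  classical
  obtain ⟨-, -, hdis, ψ, hψ, hψ_out⟩ := hsym
  let φ : Fin τ → V → V := fun j u => if h : u ∈ Q i then ψ i j ⟨u, h⟩ else u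
  have hφ : ∀ j u (h : u ∈ Q i), φ j u = ψ i j ⟨u, h⟩ := fun j u h => dif_pos h
  simp only [Set.mem_iUnion, not_exists] at hA
  refine ⟨φ, ⟨fun j k u hu v hv h => ?_, fun j u hu v hv h => ?_, fun j u hu h => ?_,
    fun j u hu a ha h => ?_⟩⟩
  · rw [hD] at hu hv
    rw [hφ j u hu, hφ k v hv] at h
    obtain rfl : j = k := by
      by_contra hjk
      exact Set.disjoint_left.1 (hdis hjk) (ψ i j ⟨u, hu⟩).2 (h ▸ (ψ i k ⟨v, hv⟩).2)
    exact ⟨rfl, congrArg Subtype.val ((ψ i j).injective (Subtype.ext h))⟩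
  · rw [hD] at hu hv
    rw [hφ j u hu, hφ j v hv]
    exact (hψ i j ⟨u, hu⟩ ⟨v, hv⟩).1 h
  · rw [hD] at hu
    rw [hφ j u hu, hA] at h
    exact h j (ψ i j ⟨u, hu⟩).2
  · rw [hD] at hu
    rw [hφ j u hu]
    exact (hψ_out i j ⟨u, hu⟩ a (by simpa using (hA a).1 ha)).1 h

/-- If `G` is `P_ℓ`-free, `S ⊆ V(G)` with `(ℓ-1) ∣ |S|` and `G[S]` is the disjoint union of
`τ ≥ ℓ` symmetric subgraphs `Q i` of `G`, and `e(G[S]) + e_G(S, V(G)-S) ≥ ((ℓ-2)/2)|S|`,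
then equality holds, and: for odd `ℓ` every `Q i` is a `K_{ℓ-1}` and there are no edges
leaving `S`; for even `ℓ`, either every `Q i` is a `K_{ℓ-1}` and no edges leave `S`, or every
`Q i` is a single vertex and some `(ℓ-2)/2` vertices outside `S` are adjacent to the unique
vertex of every `Q i`. -/
theorem desired_symmetric_subgraphs {V : Type*} [Fintype V] {ℓ : ℕ} (hℓ : 3 ≤ ℓ)
    (G : SimpleGraph V) (hfree : ¬ ContainsCopy (pathGraph ℓ) G)
    (S : Set V) {τ : ℕ} (hτ : ℓ ≤ τ)
    (Q : Fin τ → Set V) (hsym : SymmetricSubgraphs G Q)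
    (hS : S = ⋃ i, Q i)
    (hdisj : ∀ i j, i ≠ j → ∀ u ∈ Q i, ∀ v ∈ Q j, ¬ G.Adj u v)
    (hdvd : (ℓ - 1) ∣ S.ncard)
    (hge : (ℓ - 2) * S.ncard ≤ 2 * (edgesWithin G S + edgesBetween G S Sᶜ)) :
    2 * (edgesWithin G S + edgesBetween G S Sᶜ) = (ℓ - 2) * S.ncard ∧
    (Odd ℓ →
      (∀ i, IsCompleteOn G (Q i) (ℓ - 1)) ∧ edgesBetween G S Sᶜ = 0) ∧
    (Even ℓ →
      ((∀ i, IsCompleteOn G (Q i) (ℓ - 1)) ∧ edgesBetween G S Sᶜ = 0) ∨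
      ((∀ i, (Q i).ncard = 1) ∧
        ∃ B : Set V, B ⊆ Sᶜ ∧ 2 * B.ncard = ℓ - 2 ∧
          ∀ b ∈ B, ∀ i, ∀ u ∈ Q i, G.Adj b u)) := by
  classical
  let A : Finset V := Finset.univ.filter fun v => v ∉ S
  let D : Fin τ → Finset V := fun i => Finset.univ.filter fun v => v ∈ Q i
  have hA : ∀ v, v ∈ A ↔ v ∉ S := by simp [A]
  have hD : ∀ i v, v ∈ D i ↔ v ∈ Q i := by simp [D]
  have hDS : ∀ v, v ∈ Finset.univ.biUnion D ↔ v ∈ S := by simp [hD, hS]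
  obtain ⟨-, hconn, hpd, ψ, -, hψ_out⟩ := id hsym
  have hDdis : (↑(Finset.univ : Finset (Fin τ)) : Set (Fin τ)).PairwiseDisjoint D := by
    intro i _ j _ hij
    rw [Function.onFun, Finset.disjoint_left]
    intro v hi hj
    exact Set.disjoint_left.1 (hpd hij) ((hD i v).1 hi) ((hD j v).1 hj)
  have hQcard : ∀ i, (Q i).ncard = (D i).card := by
    intro i
    rw [← Set.ncard_coe_finset]
    congr 1
    ext v
    simp [hD]
  have hScard : S.ncard = ∑ i, (D i).card := by
    rw [← Finset.card_biUnion fun i hi j hj hij => hDdis hi hj hij, ← Set.ncard_coe_finset]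
    congr 1
    ext v
    exact (hDS v).symm
  have hwithin : 2 * edgesWithin G S = ∑ i, ∑ u ∈ D i, (nbrsIn G (D i) u).card := by
    rw [two_mul_edgesWithin G hDS, Finset.sum_biUnion hDdis]
    refine Finset.sum_congr rfl fun i _ => Finset.sum_congr rfl fun u hu => ?_
    congr 1
    ext z
    simp only [mem_nbrsIn, Finset.mem_biUnion, Finset.mem_univ, true_and]
    refine ⟨fun ⟨⟨j, hj⟩, hadj⟩ => ⟨?_, hadj⟩, fun h => ⟨⟨i, h.1⟩, h.2⟩⟩
    rcases eq_or_ne i j with rfl | hij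
    · exact hj
    · exact absurd hadj (hdisj i j hij u ((hD i u).1 hu) z ((hD j z).1 hj))
  have hbetween : edgesBetween G S Sᶜ = ∑ i, ∑ u ∈ D i, (nbrsIn G A u).card := by
    rw [edgesBetween_eq_sum G (T := Sᶜ) hDS hA, Finset.sum_biUnion hDdis]
  have hcore : ∀ i,
      ∑ u ∈ D i, (nbrsIn G (D i) u).card + 2 * ∑ u ∈ D i, (nbrsIn G A u).card
        ≤ (ℓ - 2) * (D i).card ∧
      (∑ u ∈ D i, (nbrsIn G (D i) u).card + 2 * ∑ u ∈ D i, (nbrsIn G A u).card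
        = (ℓ - 2) * (D i).card →
        ∀ v ∈ D i, InCliqueComponent G ℓ A (D i) v ∨ IsHalfIsolated G ℓ A (D i) v) := by
    intro i
    obtain ⟨φ, hφ⟩ := exists_symmetricCopies hsym (by simpa [hS] using hA) i (hD i)
    exact hφ.sum_le hℓ hτ hfree (D i) subset_rfl
  have htotal : 2 * (edgesWithin G S + edgesBetween G S Sᶜ) =
      ∑ i, (∑ u ∈ D i, (nbrsIn G (D i) u).card + 2 * ∑ u ∈ D i, (nbrsIn G A u).card) := by
    rw [mul_add, hwithin, hbetween, Finset.sum_add_distrib, Finset.mul_sum]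
  rw [htotal, hScard, Finset.mul_sum] at hge
  have heq := le_antisymm (Finset.sum_le_sum fun i _ => (hcore i).1) hge
  have hall := (Finset.sum_eq_sum_iff_of_le fun i _ => (hcore i).1).1 heq
  have htype : ∀ i, (IsCompleteOn G (Q i) (ℓ - 1) ∧ ∀ u ∈ D i, nbrsIn G A u = ∅) ∨
      ((Q i).ncard = 1 ∧ ∃ v ∈ Q i, 2 * (nbrsIn G A v).card = ℓ - 2) := by
    intro i
    obtain ⟨v, hv⟩ := (hconn i).nonempty
    have hvD := (hD i v).2 hv
    rcases (hcore i).2 (hall i (Finset.mem_univ i)) v hvD with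
      ⟨C, hCX, hvC, hcard, hcl, hclosed, hCA⟩ | ⟨hiso, hhalf⟩
    · obtain rfl := eq_of_connected_of_closed (hconn i) (hD i) hCX hvC hclosed
      exact Or.inl ⟨⟨(hQcard i).trans hcard, fun u hu z hz huz =>
        hcl u ((hD i u).2 hu) z ((hD i z).2 hz) huz⟩, hCA⟩
    · refine Or.inr ⟨?_, v, hv, hhalf⟩
      rw [hQcard, ← eq_of_connected_of_closed (hconn i) (hD i)
        (Finset.singleton_subset_iff.2 hvD) (Finset.mem_singleton_self v)
        (by simp [hiso]), Finset.card_singleton]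
  have hclique : (∀ i, (Q i).ncard ≠ 1) →
      (∀ i, IsCompleteOn G (Q i) (ℓ - 1)) ∧ edgesBetween G S Sᶜ = 0 := by
    intro h
    have h' := fun i => (htype i).resolve_right fun h1 => h i h1.1
    refine ⟨fun i => (h' i).1, ?_⟩
    rw [hbetween]
    exact Finset.sum_eq_zero fun i _ => Finset.sum_eq_zero fun u hu => by simp [(h' i).2 u hu]
  refine ⟨by rw [htotal, hScard, Finset.mul_sum, heq], fun hodd => hclique fun i hi => ?_,
    fun _ => ?_⟩
  · rcases htype i with h | ⟨-, v, -, hv⟩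
    · have := h.1.1
      omega
    · obtain ⟨k, rfl⟩ := hodd
      omega
  · by_cases hone : ∃ i, (Q i).ncard = 1
    · obtain ⟨i, hi⟩ := hone
      have hcard : ∀ j, (Q j).ncard = 1 := fun j => by
        rw [← hi]
        exact (Nat.card_congr (ψ i j)).symm
      obtain ⟨v, hv, hhalf⟩ : ∃ v ∈ Q i, 2 * (nbrsIn G A v).card = ℓ - 2 := by
        rcases htype i with h | h
        · have := h.1.1
          omega
        · exact h.2
      refine Or.inr ⟨hcard, nbrsIn G A v, fun b hb => ?_, by rwa [Set.ncard_coe_finset], ?_⟩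
      · exact (hA b).1 (mem_nbrsIn.1 hb).1
      · intro b hb j u hu
        obtain ⟨hbA, hadj⟩ := mem_nbrsIn.1 (Finset.mem_coe.1 hb)
        have h := (hψ_out i j ⟨v, hv⟩ b ⟨trivial, hS ▸ (hA b).1 hbA⟩).1 hadj
        obtain ⟨w, hw⟩ := Set.ncard_eq_one.1 (hcard j)
        have h1 : (ψ i j ⟨v, hv⟩ : V) = w := by
          simpa [hw] using (ψ i j ⟨v, hv⟩).2
        have h2 : u = w := by simpa [hw] using hu
        rw [h2, ← h1]
        exact h.symm
    · exact Or.inl (hclique fun i hi => hone ⟨i, hi⟩)
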